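/- Let A and B be subcomplexes of a finite simplicial complex with A ∩ B nonempty, and suppose |A| and |B| are contractible. Then |A ∪ B| is homotopy equivalent to susp(|A ∩ B|), the unreduced suspension of |A ∩ B|. -/

import Mathlib

open Finset

/-- A finite abstract simplicial complex: a collection of nonempty finite sets closed
under taking nonempty subsets. -/
def IsComplex {V : Type} (K : Finset (Finset V)) : Prop :=
  ∀ s ∈ K, s.Nonempty ∧ ∀ t, t ⊆ s → t.Nonempty → t ∈ K

/-- Geometric realization of the finite abstract simplicial complex `K`, as a subspace of
`V → ℝ`: the convex combinations of vertices whose support is a face of `K`. -/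
def realization {V : Type} [Fintype V] (K : Finset (Finset V)) : Set (V → ℝ) :=
  {x | (∀ v, 0 ≤ x v) ∧ (∑ v, x v) = 1 ∧ ∃ s ∈ K, ∀ v, x v ≠ 0 ↔ v ∈ s}

lemma realization_mono {V : Type} [Fintype V] {K L : Finset (Finset V)} (h : K ⊆ L) :
    realization K ⊆ realization L := by
  rintro x ⟨h0, h1, s, hs, hsupp⟩
  exact ⟨h0, h1, s, h hs, hsupp⟩

/-- The inclusion map between geometric realizations induced by an inclusion of complexes. -/
def inclMap {V : Type} [Fintype V] {K L : Finset (Finset V)} (h : K ⊆ L) :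
    C(↥(realization K), ↥(realization L)) :=
  ⟨Set.inclusion (realization_mono h), continuous_inclusion (realization_mono h)⟩

/-- The unreduced suspension of a topological space `X`: the quotient of `X × [0,1]`
collapsing `X × {0}` to a point and `X × {1}` to a point. -/
def Susp (X : Type) [TopologicalSpace X] : Type :=
  Quot fun p q : X × unitInterval => p.2 = q.2 ∧ (p.2 = 0 ∨ p.2 = 1)

instance (X : Type) [TopologicalSpace X] : TopologicalSpace (Susp X) :=
  inferInstanceAs (TopologicalSpace (Quot _))

/-- The wedge (one-point union) of three pointed spaces: the disjoint union with the three
base points identified. -/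
def Wedge3 (X Y Z : Type) [TopologicalSpace X] [TopologicalSpace Y] [TopologicalSpace Z]
    (x₀ : X) (y₀ : Y) (z₀ : Z) : Type :=
  Quot fun u v : X ⊕ Y ⊕ Z =>
    (u = Sum.inl x₀ ∧ v = Sum.inr (Sum.inl y₀)) ∨
    (u = Sum.inl x₀ ∧ v = Sum.inr (Sum.inr z₀))

instance (X Y Z : Type) [TopologicalSpace X] [TopologicalSpace Y] [TopologicalSpace Z]
    (x₀ : X) (y₀ : Y) (z₀ : Z) : TopologicalSpace (Wedge3 X Y Z x₀ y₀ z₀) :=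
  inferInstanceAs (TopologicalSpace (Quot _))

open Topology unitInterval

/-- Continuous functions on the two members of a closed cover that agree on the overlap glue to a
continuous map. -/
lemma exists_continuousMap_of_closed_cover {Z W : Type*} [TopologicalSpace Z] [TopologicalSpace W]
    (S : Bool → Set Z) (hS : ∀ i, IsClosed (S i)) (hcover : ∀ z, ∃ i, z ∈ S i)
    (g : Bool → Z → W) (hg : ∀ i, ContinuousOn (g i) (S i))
    (hagree : ∀ z, z ∈ S false → z ∈ S true → g false z = g true z) :
    ∃ F : C(Z, W), ∀ i, ∀ z ∈ S i, F z = g i z := by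
  classical
  let F : Z → W := fun z => if z ∈ S false then g false z else g true z
  have hF : ∀ i, ∀ z ∈ S i, F z = g i z := by
    rintro (_ | _) z hz
    · simp [F, hz]
    · by_cases h : z ∈ S false
      · simp [F, h, hagree z h hz]
      · simp [F, h]
  have hunion : S false ∪ S true = Set.univ := by
    ext z
    simpa [Bool.exists_bool] using hcover z
  have hcont : ContinuousOn F (S false ∪ S true) :=
    ((hg false).congr (hF false)).union_of_isClosed ((hg true).congr (hF true))
      (hS false) (hS true)
  rw [hunion, continuousOn_univ] at hcont
  exact ⟨⟨F, hcont⟩, hF⟩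

/-- A presentation of `Y` as a union of two closed contractible subspaces meeting in a closed copy
of `C`, together with data exhibiting `C` as a neighbourhood deformation retract compatible with
both subspaces. -/
structure ContractibleTriad (C Y : Type*) [TopologicalSpace C] [TopologicalSpace Y] where
  /-- The inclusion of the common part. -/
  incl : C → Y
  isClosedEmbedding_incl : IsClosedEmbedding incl
  /-- The two closed subspaces. -/
  side : Bool → Set Y
  isClosed_side : ∀ i, IsClosed (side i)
  exists_mem_side : ∀ y, ∃ i, y ∈ side i
  incl_mem_side : ∀ i c, incl c ∈ side i
  exists_incl_eq : ∀ y, y ∈ side false → y ∈ side true → ∃ c, incl c = y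
  /-- The point to which each subspace contracts. -/
  center : Bool → Y
  center_mem : ∀ i, center i ∈ side i
  /-- The contractions of the two subspaces. -/
  contract : Bool → I × Y → Y
  continuousOn_contract : ∀ i, ContinuousOn (contract i) (Set.univ ×ˢ side i)
  contract_mem : ∀ i t, ∀ y ∈ side i, contract i (t, y) ∈ side i
  contract_zero : ∀ i, ∀ y ∈ side i, contract i (0, y) = y
  contract_one : ∀ i, ∀ y ∈ side i, contract i (1, y) = center i
  /-- The deformation of a neighbourhood of the common part. -/
  deform : C(I × Y, Y)
  deform_zero : ∀ y, deform (0, y) = y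
  deform_mem : ∀ i t, ∀ y ∈ side i, deform (t, y) ∈ side i
  deform_incl : ∀ t c, deform (t, incl c) = incl c
  /-- A function vanishing on the common part and less than `1` only near it. -/
  height : C(Y, I)
  height_incl : ∀ c, height (incl c) = 0
  deform_one_mem : ∀ y, height y ≠ 1 → ∃ c, incl c = deform (1, y)

namespace ContractibleTriad

variable {C Y Y' : Type*} [TopologicalSpace C] [TopologicalSpace Y] [TopologicalSpace Y']

/-- There is a map between any two triads with the same common part that preserves the subspaces
and is the identity on the common part. -/
lemma exists_map (T : ContractibleTriad C Y) (T' : ContractibleTriad C Y') :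
    ∃ f : C(Y, Y'), (∀ c, f (T.incl c) = T'.incl c) ∧ ∀ i, ∀ y ∈ T.side i, f y ∈ T'.side i := by
  let e : Bool → Y → Y' := fun i => Function.extend T.incl T'.incl fun _ => T'.center i
  have he : ∀ i c, e i (T.incl c) = T'.incl c := fun i c =>
    T.isClosedEmbedding_incl.injective.extend_apply _ _ c
  have he_mem : ∀ i y, e i y ∈ T'.side i := by
    intro i y
    by_cases h : ∃ c, T.incl c = y
    · obtain ⟨c, rfl⟩ := h
      rw [he]
      exact T'.incl_mem_side i c
    · simp only [e, Function.extend_apply' _ _ _ h]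
      exact T'.center_mem i
  have he_cont : ∀ i, ContinuousOn (e i) (Set.range T.incl) := by
    intro i
    rw [continuousOn_iff_continuous_domRestrict]
    have heq : (Set.range T.incl).domRestrict (e i) =
        T'.incl ∘ T.isClosedEmbedding_incl.isEmbedding.toHomeomorph.symm := by
      funext y
      obtain ⟨c, rfl⟩ := T.isClosedEmbedding_incl.isEmbedding.toHomeomorph.surjective y
      simpa using he i c
    rw [heq]
    exact T'.isClosedEmbedding_incl.continuous.comp (Homeomorph.continuous _)
  let g : Bool → Y → Y' := fun i y => T'.contract i (T.height y, e i (T.deform (1, y)))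
  have hg : ∀ i, ContinuousOn (g i) (T.side i) := by
    intro i
    have hdef : Continuous fun y => T.deform (1, y) := by fun_prop
    have hnear : ContinuousOn (g i) ((fun y => T.deform (1, y)) ⁻¹' Set.range T.incl) := by
      refine (T'.continuousOn_contract i).comp
        (T.height.continuous.continuousOn.prodMk ((he_cont i).comp hdef.continuousOn ?_)) ?_
      · exact fun y hy => hy
      · exact fun y _ => ⟨trivial, he_mem i _⟩
    have hfar : ContinuousOn (g i) (T.height ⁻¹' {1}) := by
      refine (continuousOn_const (c := T'.center i)).congr fun y hy => ?_
      have hy1 : T.height y = 1 := hy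
      simp only [g, hy1]
      exact T'.contract_one i _ (he_mem i _)
    refine (hnear.union_of_isClosed hfar
      (T.isClosedEmbedding_incl.isClosed_range.preimage hdef)
      (isClosed_singleton.preimage T.height.continuous)).mono fun y _ => ?_
    by_cases h : T.height y = 1
    · exact Or.inr h
    · exact Or.inl (T.deform_one_mem y h)
  have hg_incl : ∀ i c, g i (T.incl c) = T'.incl c := by
    intro i c
    simp only [g, T.height_incl, T.deform_incl, he]
    exact T'.contract_zero i _ (T'.incl_mem_side i c)
  obtain ⟨f, hf⟩ := exists_continuousMap_of_closed_cover T.side T.isClosed_side T.exists_mem_side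
    g hg (by
      intro y h0 h1
      obtain ⟨c, rfl⟩ := T.exists_incl_eq y h0 h1
      rw [hg_incl, hg_incl])
  refine ⟨f, fun c => ?_, fun i y hy => ?_⟩
  · rw [hf false _ (T.incl_mem_side false c), hg_incl]
  · rw [hf i y hy]
    exact T'.contract_mem i _ _ (he_mem i _)

/-- All self-maps of a triad that preserve the subspaces and fix the common part are homotopic to
one and the same map. -/
lemma exists_forall_homotopic (T : ContractibleTriad C Y) :
    ∃ E : C(Y, Y), ∀ k : C(Y, Y), (∀ c, k (T.incl c) = T.incl c) →
      (∀ i, ∀ y ∈ T.side i, k y ∈ T.side i) → k.Homotopic E := by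
  have hglue : ∀ k : C(Y, Y), (∀ c, k (T.incl c) = T.incl c) →
      (∀ i, ∀ y ∈ T.side i, k y ∈ T.side i) →
      ∃ F : C(I × Y, Y), ∀ i t, ∀ y ∈ T.side i,
        F (t, y) = T.contract i (t * T.height y, k (T.deform (1, y))) := by
    intro k hk hside
    obtain ⟨F, hF⟩ := exists_continuousMap_of_closed_cover
      (fun i => (Set.univ : Set I) ×ˢ T.side i) (fun i => isClosed_univ.prod (T.isClosed_side i))
      (fun z => (T.exists_mem_side z.2).imp fun i hi => ⟨trivial, hi⟩)
      (fun i z => T.contract i (z.1 * T.height z.2, k (T.deform (1, z.2))))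
      (fun i => (T.continuousOn_contract i).comp (by fun_prop)
        fun z hz => ⟨trivial, hside i _ (T.deform_mem i _ _ hz.2)⟩)
      (by
        rintro ⟨t, y⟩ ⟨-, h0⟩ ⟨-, h1⟩
        obtain ⟨c, rfl⟩ := T.exists_incl_eq y h0 h1
        simp only [T.height_incl, T.deform_incl, hk, mul_zero]
        rw [T.contract_zero _ _ (T.incl_mem_side _ c), T.contract_zero _ _ (T.incl_mem_side _ c)])
    exact ⟨F, fun i t y hy => hF i (t, y) ⟨trivial, hy⟩⟩
  obtain ⟨F₀, hF₀⟩ := hglue (ContinuousMap.id Y) (fun _ => rfl) fun _ _ hy => hy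
  refine ⟨⟨fun y => F₀ (1, y), by fun_prop⟩, fun k hk hside => ?_⟩
  obtain ⟨F, hF⟩ := hglue k hk hside
  let kφ : C(Y, Y) := ⟨fun y => k (T.deform (1, y)), by fun_prop⟩
  have h₁ : k.Homotopic kφ :=
    ⟨{ toFun := fun p => k (T.deform p)
       continuous_toFun := by fun_prop
       map_zero_left := fun y => by simp [T.deform_zero]
       map_one_left := fun y => rfl }⟩
  refine h₁.trans
    ⟨{ toFun := F
       continuous_toFun := F.continuous
       map_zero_left := fun y => ?_
       map_one_left := fun y => ?_ }⟩
  · obtain ⟨i, hi⟩ := T.exists_mem_side y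
    rw [hF i 0 y hi, zero_mul]
    exact T.contract_zero i _ (hside i _ (T.deform_mem i _ _ hi))
  · obtain ⟨i, hi⟩ := T.exists_mem_side y
    change F (1, y) = F₀ (1, y)
    rw [hF i 1 y hi, hF₀ i 1 y hi, one_mul, ContinuousMap.id_apply]
    by_cases h : T.height y = 1
    · rw [h, T.contract_one i _ (hside i _ (T.deform_mem i _ _ hi)),
        T.contract_one i _ (T.deform_mem i _ _ hi)]
    · obtain ⟨c, hc⟩ := T.deform_one_mem y h
      rw [← hc, hk]

lemma homotopic_id (T : ContractibleTriad C Y) (k : C(Y, Y)) (hk : ∀ c, k (T.incl c) = T.incl c)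
    (hside : ∀ i, ∀ y ∈ T.side i, k y ∈ T.side i) : k.Homotopic (ContinuousMap.id Y) := by
  obtain ⟨E, hE⟩ := T.exists_forall_homotopic
  exact (hE k hk hside).trans (hE (ContinuousMap.id Y) (fun _ => rfl) fun _ _ hy => hy).symm

/-- Two triads with the same common part are homotopy equivalent. -/
theorem nonempty_homotopyEquiv (T : ContractibleTriad C Y) (T' : ContractibleTriad C Y') :
    Nonempty (ContinuousMap.HomotopyEquiv Y Y') := by
  obtain ⟨f, hf, hf_side⟩ := T.exists_map T'
  obtain ⟨g, hg, hg_side⟩ := T'.exists_map T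
  exact ⟨{ toFun := f
           invFun := g
           left_inv := T.homotopic_id _ (fun c => by simp [hf, hg])
             fun i y hy => hg_side i _ (hf_side i y hy)
           right_inv := T'.homotopic_id _ (fun c => by simp [hf, hg])
             fun i y hy => hf_side i _ (hg_side i y hy) }⟩

end ContractibleTriad

namespace Susp

variable {X : Type} [TopologicalSpace X]

/-- The point of the suspension over `x` at level `t`. -/
def mk (x : X) (t : I) : Susp X := Quot.mk _ (x, t)

lemma isQuotientMap_mk : IsQuotientMap fun p : X × I => mk p.1 p.2 := isQuotientMap_quot_mk

lemma mk_zero (x y : X) : mk x 0 = mk y 0 := Quot.sound ⟨rfl, Or.inl rfl⟩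

lemma mk_one (x y : X) : mk x 1 = mk y 1 := Quot.sound ⟨rfl, Or.inr rfl⟩

/-- The level of a point of the suspension. -/
def level : C(Susp X, I) where
  toFun := Quot.lift (fun p : X × I => p.2) fun _ _ h => h.1
  continuous_toFun := continuous_quot_lift _ continuous_snd

@[simp] lemma level_mk (x : X) (t : I) : level (mk x t) = t := rfl

lemma exists_mk_eq (y : Susp X) : ∃ x t, mk x t = y := by
  obtain ⟨⟨x, t⟩, h⟩ := isQuotientMap_mk.surjective y
  exact ⟨x, t, h⟩

lemma mk_eq_mk_iff {x y : X} {s t : I} (h0 : t ≠ 0) (h1 : t ≠ 1) :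
    mk x s = mk y t ↔ x = y ∧ s = t := by
  refine ⟨fun h => ?_, fun ⟨hx, ht⟩ => by rw [hx, ht]⟩
  let P : Susp X → Prop := Quot.lift (fun p : X × I => p.1 = y ∧ p.2 = t) (by
    rintro ⟨a, u⟩ ⟨b, v⟩ ⟨huv, hu⟩
    simp only at huv hu
    subst huv
    have hne : u ≠ t := by
      rintro rfl
      exact hu.elim h0 h1
    simp [hne])
  have hP : P (mk x s) = P (mk y t) := congrArg P h
  have : (x = y ∧ s = t) = (y = y ∧ t = t) := hP
  simpa using this

lemma isClosedEmbedding_mk {t : I} (h0 : t ≠ 0) (h1 : t ≠ 1) :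
    IsClosedEmbedding fun x : X => mk x t := by
  refine .of_continuous_injective_isClosedMap
    (isQuotientMap_mk.continuous.comp (Continuous.prodMk_left t))
    (fun x y h => ((mk_eq_mk_iff h0 h1).1 h).1) fun S hS => ?_
  rw [← isQuotientMap_mk.isClosed_preimage]
  convert! hS.prod (isClosed_singleton (x := t)) using 1
  ext ⟨x, s⟩
  simp only [Set.mem_preimage, Set.mem_image, Set.mem_prod, Set.mem_singleton_iff]
  constructor
  · rintro ⟨y, hy, h⟩
    obtain ⟨rfl, rfl⟩ := (mk_eq_mk_iff h0 h1).1 h.symm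
    exact ⟨hy, rfl⟩
  · rintro ⟨hx, rfl⟩
    exact ⟨x, hx, rfl⟩

/-- A homotopy of the unit interval fixing its endpoints induces a homotopy of the suspension. -/
def reparam (θ : C(I × I, I)) (h0 : ∀ s, θ (s, 0) = 0) (h1 : ∀ s, θ (s, 1) = 1) :
    C(I × Susp X, Susp X) where
  toFun q := Quot.lift (fun p : X × I => mk p.1 (θ (q.1, p.2))) (by
    rintro ⟨a, u⟩ ⟨b, v⟩ ⟨huv, hu⟩
    simp only at huv hu
    subst huv
    rcases hu with rfl | rfl
    · simp only [h0]
      exact mk_zero a b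
    · simp only [h1]
      exact mk_one a b) q.2
  continuous_toFun := by
    refine isQuotientMap_mk.continuous_lift_prod_right ?_
    exact isQuotientMap_mk.continuous.comp
      (f := fun q : I × (X × I) => (q.2.1, θ (q.1, q.2.2))) (by fun_prop)

@[simp] lemma reparam_mk (θ : C(I × I, I)) (h0 : ∀ s, θ (s, 0) = 0) (h1 : ∀ s, θ (s, 1) = 1)
    (s : I) (x : X) (t : I) : reparam θ h0 h1 (s, mk x t) = mk x (θ (s, t)) := rfl

/-- The homotopy of the unit interval given by a continuous real function, clamped to `[0, 1]`. -/
noncomputable def clampHomotopy (f : ℝ → ℝ → ℝ) (hf : Continuous fun p : ℝ × ℝ => f p.1 p.2) :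
    C(I × I, I) where
  toFun p := Set.projIcc 0 1 zero_le_one (f p.1 p.2)
  continuous_toFun := continuous_projIcc.comp
    (hf.comp (f := fun p : I × I => ((p.1 : ℝ), (p.2 : ℝ))) (by fun_prop))

lemma coe_clampHomotopy (f : ℝ → ℝ → ℝ) (hf : Continuous fun p : ℝ × ℝ => f p.1 p.2) (s t : I) :
    (clampHomotopy f hf (s, t) : ℝ) = max 0 (min 1 (f s t)) := rfl

/-- Contracts `[0, 1/2]` to `0`, fixing the endpoints of the unit interval. -/
noncomputable def lowerContraction : C(I × I, I) :=
  clampHomotopy (fun s t => max (t * (1 - s)) (2 * t - 1)) (by fun_prop)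

/-- Contracts `[1/2, 1]` to `1`, fixing the endpoints of the unit interval. -/
noncomputable def upperContraction : C(I × I, I) :=
  clampHomotopy (fun s t => min (1 - (1 - t) * (1 - s)) (2 * t)) (by fun_prop)

/-- Deforms `[1/4, 3/4]` to `1/2`, fixing the endpoints of the unit interval. -/
noncomputable def middleDeformation : C(I × I, I) :=
  clampHomotopy (fun s t => (1 - s) * t + s * min (2 * t) (max (1 / 2) (2 * t - 1))) (by fun_prop)

lemma coe_lowerContraction (s t : I) :
    (lowerContraction (s, t) : ℝ) = max (t * (1 - s) : ℝ) (2 * t - 1) := by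
  have := s.2.1; have := s.2.2; have := t.2.1; have := t.2.2
  rw [lowerContraction, coe_clampHomotopy, min_eq_right, max_eq_right]
  · exact le_max_of_le_left (by nlinarith)
  · exact max_le (by nlinarith) (by linarith)

lemma coe_upperContraction (s t : I) :
    (upperContraction (s, t) : ℝ) = min (1 - (1 - t) * (1 - s) : ℝ) (2 * t) := by
  have := s.2.1; have := s.2.2; have := t.2.1; have := t.2.2
  rw [upperContraction, coe_clampHomotopy, min_eq_right, max_eq_right]
  · exact le_min (by nlinarith) (by linarith)
  · exact min_le_of_left_le (by nlinarith)

lemma coe_middleDeformation (s t : I) :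
    (middleDeformation (s, t) : ℝ) =
      (1 - s) * t + s * min (2 * t : ℝ) (max (1 / 2) (2 * t - 1)) := by
  have := s.2.1; have := s.2.2; have := t.2.1; have := t.2.2
  have h0 : 0 ≤ min (2 * t : ℝ) (max (1 / 2) (2 * t - 1)) :=
    le_min (by linarith) (le_max_of_le_left (by norm_num))
  have h1 : min (2 * t : ℝ) (max (1 / 2) (2 * t - 1)) ≤ 1 :=
    min_le_of_right_le (max_le (by norm_num) (by linarith))
  rw [middleDeformation, coe_clampHomotopy, min_eq_right, max_eq_right]
  · nlinarith
  · nlinarith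

lemma lowerContraction_zero (s : I) : lowerContraction (s, 0) = 0 :=
  Subtype.ext (by simp [coe_lowerContraction])

lemma lowerContraction_one (s : I) : lowerContraction (s, 1) = 1 := by
  have := s.2.1
  refine Subtype.ext ?_
  rw [coe_lowerContraction, max_eq_right] <;> simp only [Set.Icc.coe_one] <;> linarith

lemma upperContraction_zero (s : I) : upperContraction (s, 0) = 0 := by
  have := s.2.1
  refine Subtype.ext ?_
  rw [coe_upperContraction, min_eq_right] <;> simp only [Set.Icc.coe_zero] <;> linarith

lemma upperContraction_one (s : I) : upperContraction (s, 1) = 1 :=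
  Subtype.ext (by norm_num [coe_upperContraction])

lemma middleDeformation_zero (s : I) : middleDeformation (s, 0) = 0 :=
  Subtype.ext (by norm_num [coe_middleDeformation])

lemma middleDeformation_one (s : I) : middleDeformation (s, 1) = 1 :=
  Subtype.ext (by norm_num [coe_middleDeformation])

/-- The suspension as the union of two cones meeting in the middle copy of the base. -/
noncomputable def contractibleTriad [Nonempty X] : ContractibleTriad X (Susp X) where
  incl x := mk x ⟨1 / 2, by norm_num, by norm_num⟩
  isClosedEmbedding_incl := isClosedEmbedding_mk (t := ⟨1 / 2, by norm_num, by norm_num⟩)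
    (fun h => by have := congrArg Subtype.val h; norm_num at this)
    (fun h => by have := congrArg Subtype.val h; norm_num at this)
  side i := bif i then {y | (1 / 2 : ℝ) ≤ level y} else {y | (level y : ℝ) ≤ 1 / 2}
  isClosed_side := by
    rintro (_ | _)
    · exact isClosed_le (by fun_prop) continuous_const
    · exact isClosed_le continuous_const (by fun_prop)
  exists_mem_side y := by
    rcases le_total (level y : ℝ) (1 / 2) with h | h
    · exact ⟨false, h⟩
    · exact ⟨true, h⟩
  incl_mem_side i x := by cases i <;> simp
  exists_incl_eq y := by
    obtain ⟨x, t, rfl⟩ := exists_mk_eq y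
    intro h0 h1
    exact ⟨x, congrArg (mk x) (Subtype.ext (le_antisymm h1 h0))⟩
  center i := mk (Classical.arbitrary X) (bif i then 1 else 0)
  center_mem i := by cases i <;> norm_num
  contract i := bif i then reparam upperContraction upperContraction_zero upperContraction_one
    else reparam lowerContraction lowerContraction_zero lowerContraction_one
  continuousOn_contract i := by cases i <;> exact (ContinuousMap.continuous _).continuousOn
  contract_mem i s y := by
    obtain ⟨x, t, rfl⟩ := exists_mk_eq y
    have := s.2.1; have := s.2.2; have := t.2.1; have := t.2.2
    cases i <;>
      simp only [cond_true, cond_false, Set.mem_ofPred_eq, level_mk, reparam_mk,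
        coe_lowerContraction, coe_upperContraction] <;> intro h
    · exact max_le (by nlinarith) (by linarith)
    · exact le_min (by nlinarith) (by linarith)
  contract_zero i y := by
    obtain ⟨x, t, rfl⟩ := exists_mk_eq y
    have := t.2.1; have := t.2.2
    cases i <;>
      simp only [cond_true, cond_false, Set.mem_ofPred_eq, level_mk, reparam_mk] <;> intro h <;>
      refine congrArg (mk x) (Subtype.ext ?_)
    · rw [coe_lowerContraction, max_eq_left] <;> simp only [Set.Icc.coe_zero] <;> linarith
    · rw [coe_upperContraction, min_eq_left] <;> simp only [Set.Icc.coe_zero] <;> linarith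
  contract_one i y := by
    obtain ⟨x, t, rfl⟩ := exists_mk_eq y
    cases i <;>
      simp only [cond_true, cond_false, Set.mem_ofPred_eq, level_mk, reparam_mk] <;> intro h
    · have ht : lowerContraction (1, t) = 0 := by
        refine Subtype.ext ?_
        rw [coe_lowerContraction, max_eq_left] <;>
          simp only [Set.Icc.coe_one, Set.Icc.coe_zero] <;> linarith
      rw [ht]
      exact mk_zero _ _
    · have ht : upperContraction (1, t) = 1 := by
        refine Subtype.ext ?_
        rw [coe_upperContraction, min_eq_left] <;> simp only [Set.Icc.coe_one] <;> linarith
      rw [ht]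
      exact mk_one _ _
  deform := reparam middleDeformation middleDeformation_zero middleDeformation_one
  deform_zero y := by
    obtain ⟨x, t, rfl⟩ := exists_mk_eq y
    exact congrArg (mk x) (Subtype.ext (by simp [coe_middleDeformation]))
  deform_mem i s y := by
    obtain ⟨x, t, rfl⟩ := exists_mk_eq y
    have := s.2.1; have := s.2.2; have := t.2.1; have := t.2.2
    cases i <;>
      simp only [cond_true, cond_false, Set.mem_ofPred_eq, level_mk, reparam_mk,
        coe_middleDeformation] <;> intro h
    · have : min (2 * t : ℝ) (max (1 / 2) (2 * t - 1)) ≤ 1 / 2 :=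
        min_le_of_right_le (max_le le_rfl (by linarith))
      nlinarith
    · have : 1 / 2 ≤ min (2 * t : ℝ) (max (1 / 2) (2 * t - 1)) :=
        le_min (by linarith) (le_max_left _ _)
      nlinarith
  deform_incl s x := by
    refine congrArg (mk x) (Subtype.ext ?_)
    norm_num [coe_middleDeformation]
    ring
  height :=
    { toFun := fun y => Set.projIcc 0 1 zero_le_one (4 * |(level y : ℝ) - 1 / 2|)
      continuous_toFun := continuous_projIcc.comp (by fun_prop) }
  height_incl x := by simp
  deform_one_mem y := by
    obtain ⟨x, t, rfl⟩ := exists_mk_eq y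
    intro h
    have ht : |(t : ℝ) - 1 / 2| < 1 / 4 := by
      by_contra! hle
      exact h (Set.projIcc_of_right_le zero_le_one (by rw [level_mk]; linarith))
    rw [abs_lt] at ht
    refine ⟨x, congrArg (mk x) (Subtype.ext ?_)⟩
    rw [coe_middleDeformation, max_eq_left (by linarith), min_eq_right (by linarith)]
    simp

end Susp

section Realization

lemma IsComplex.union {V : Type} [DecidableEq V] {K L : Finset (Finset V)}
    (hK : IsComplex K) (hL : IsComplex L) : IsComplex (K ∪ L) := by
  intro s hs
  rcases mem_union.1 hs with h | h
  · exact ⟨(hK s h).1, fun t ht hne => mem_union_left _ ((hK s h).2 t ht hne)⟩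
  · exact ⟨(hL s h).1, fun t ht hne => mem_union_right _ ((hL s h).2 t ht hne)⟩

lemma IsComplex.inter {V : Type} [DecidableEq V] {K L : Finset (Finset V)}
    (hK : IsComplex K) (hL : IsComplex L) : IsComplex (K ∩ L) := by
  intro s hs
  obtain ⟨h, h'⟩ := mem_inter.1 hs
  exact ⟨(hK s h).1, fun t ht hne =>
    mem_inter.2 ⟨(hK s h).2 t ht hne, (hL s h').2 t ht hne⟩⟩

variable {V : Type} [Fintype V] {K L : Finset (Finset V)} {x : V → ℝ}

lemma mem_realization_iff (hK : IsComplex K) :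
    x ∈ realization K ↔ (∀ v, 0 ≤ x v) ∧ ∑ v, x v = 1 ∧ ∃ s ∈ K, ∀ v ∉ s, x v = 0 := by
  classical
  constructor
  · rintro ⟨h0, h1, s, hs, hx⟩
    exact ⟨h0, h1, s, hs, fun v hv => not_not.1 fun h => hv ((hx v).1 h)⟩
  · rintro ⟨h0, h1, s, hs, hx⟩
    refine ⟨h0, h1, univ.filter fun v => x v ≠ 0, (hK s hs).2 _ ?_ ?_, by simp⟩
    · intro v hv
      by_contra hvs
      exact (mem_filter.1 hv).2 (hx v hvs)
    · obtain ⟨v, -, hv⟩ := exists_ne_zero_of_sum_ne_zero (h1.trans_ne one_ne_zero)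
      exact ⟨v, by simpa using hv⟩

lemma isClosed_realization (hK : IsComplex K) : IsClosed (realization K) := by
  have heq : realization K = {x | ∀ v, 0 ≤ x v} ∩ ({x | ∑ v, x v = 1} ∩
      ⋃ s ∈ K, {x | ∀ v ∉ s, x v = 0}) := by
    ext x
    simp [mem_realization_iff hK]
  rw [heq]
  refine IsClosed.inter ?_ (IsClosed.inter ?_ (Set.Finite.isClosed_biUnion K.finite_toSet ?_))
  · simp only [Set.ofPred_forall]
    exact isClosed_iInter fun v => isClosed_le continuous_const (continuous_apply v)
  · exact isClosed_eq (by fun_prop) continuous_const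
  · intro s _
    simp only [Set.ofPred_forall]
    exact isClosed_iInter fun v => isClosed_iInter fun _ =>
      isClosed_eq (continuous_apply v) continuous_const

lemma mem_realization_inter [DecidableEq V] (hK : x ∈ realization K) (hL : x ∈ realization L) :
    x ∈ realization (K ∩ L) := by
  obtain ⟨h0, h1, s, hs, hxs⟩ := hK
  obtain ⟨-, -, t, ht, hxt⟩ := hL
  have hst : s = t := by
    ext v
    rw [← hxs, hxt]
  subst hst
  exact ⟨h0, h1, s, mem_inter.2 ⟨hs, ht⟩, hxs⟩

lemma mem_realization_union [DecidableEq V] (hx : x ∈ realization (K ∪ L)) :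
    x ∈ realization K ∨ x ∈ realization L := by
  obtain ⟨h0, h1, s, hs, hxs⟩ := hx
  exact (mem_union.1 hs).imp (fun h => ⟨h0, h1, s, h, hxs⟩) fun h => ⟨h0, h1, s, h, hxs⟩

lemma nonempty_realization (hK : IsComplex K) (hne : K.Nonempty) : (realization K).Nonempty := by
  classical
  obtain ⟨s, hs⟩ := hne
  obtain ⟨v, hv⟩ := (hK s hs).1
  refine ⟨Pi.single v 1, (mem_realization_iff hK).2 ⟨fun w => ?_, by simp, s, hs, fun w hw => ?_⟩⟩
  · exact (Pi.single_nonneg.2 zero_le_one : (0 : V → ℝ) ≤ Pi.single v 1) w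
  · exact Pi.single_eq_of_ne (ne_of_mem_of_not_mem hv hw).symm _

/-- A contraction of `realization L`, extended by the identity to a larger realization. -/
lemma exists_contraction {M : Finset (Finset V)} (hLM : L ⊆ M)
    [ContractibleSpace (realization L)] :
    ∃ (y : realization M) (H : I × realization M → realization M), y.1 ∈ realization L ∧
      ContinuousOn H (Set.univ ×ˢ {x | x.1 ∈ realization L}) ∧
      (∀ t, ∀ x : realization M, x.1 ∈ realization L → (H (t, x)).1 ∈ realization L) ∧
      (∀ x : realization M, x.1 ∈ realization L → H (0, x) = x) ∧
      ∀ x : realization M, x.1 ∈ realization L → H (1, x) = y := by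
  classical
  obtain ⟨p, ⟨h⟩⟩ := id_nullhomotopic (realization L)
  let H : I × realization M → realization M := fun q =>
    if hq : q.2.1 ∈ realization L then inclMap hLM (h (q.1, ⟨q.2.1, hq⟩)) else q.2
  have hH : ∀ t (x : realization M) (hx : x.1 ∈ realization L),
      H (t, x) = inclMap hLM (h (t, ⟨x.1, hx⟩)) := fun t x hx => dif_pos hx
  refine ⟨inclMap hLM p, H, p.2, ?_, fun t x hx => ?_, fun x hx => ?_, fun x hx => ?_⟩
  · rw [continuousOn_iff_continuous_domRestrict]
    have heq : (Set.univ ×ˢ {x : realization M | x.1 ∈ realization L}).domRestrict H =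
        fun q => inclMap hLM (h (q.1.1, ⟨q.1.2.1, q.2.2⟩)) := by
      funext q
      exact hH _ _ q.2.2
    rw [heq]
    fun_prop
  · rw [hH t x hx]
    exact (h _).2
  · rw [hH 0 x hx, h.apply_zero]
    rfl
  · rw [hH 1 x hx, h.apply_one]
    rfl

/-- The least mass that `x` puts outside a face of `K`. -/
noncomputable def massOutside [DecidableEq V] (hne : K.Nonempty) (x : V → ℝ) : ℝ :=
  K.inf' hne fun s => ∑ v ∈ sᶜ, x v

/-- The total mass of `x` above the threshold `massOutside`. -/
noncomputable def massAbove [DecidableEq V] (hne : K.Nonempty) (x : V → ℝ) : ℝ :=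
  ∑ v, max (x v - massOutside hne x) 0

/-- The straight-line deformation which, near `realization K`, ends at the normalization of the
part of `x` above the threshold `massOutside`. -/
noncomputable def pushToward [DecidableEq V] (hne : K.Nonempty) (t : ℝ) (x : V → ℝ) : V → ℝ :=
  fun v => (1 - t * (massAbove hne x / max (massAbove hne x) (1 / 2))) * x v +
    t * (max (x v - massOutside hne x) 0 / max (massAbove hne x) (1 / 2))

variable [DecidableEq V] (hne : K.Nonempty)

lemma continuous_massOutside : Continuous (massOutside hne) :=
  Continuous.finset_inf'_apply hne fun s _ => by fun_prop

lemma continuous_massAbove : Continuous (massAbove hne) := by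
  have := continuous_massOutside hne
  unfold massAbove
  fun_prop

lemma continuous_pushToward : Continuous fun p : ℝ × (V → ℝ) => pushToward hne p.1 p.2 := by
  have h1 := continuous_massOutside hne
  have h2 := continuous_massAbove hne
  have h3 : ∀ p : ℝ × (V → ℝ), max (massAbove hne p.2) (1 / 2) ≠ 0 := fun p =>
    (lt_max_of_lt_right (by norm_num)).ne'
  unfold pushToward
  refine continuous_pi fun v => ?_
  fun_prop (disch := exact h3)

lemma massOutside_nonneg (h0 : ∀ v, 0 ≤ x v) : 0 ≤ massOutside hne x :=
  le_inf' _ _ fun _ _ => sum_nonneg fun v _ => h0 v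

lemma massAbove_nonneg : 0 ≤ massAbove hne x := sum_nonneg fun _ _ => le_max_right _ _

lemma massOutside_eq_zero (hx : x ∈ realization K) : massOutside hne x = 0 := by
  obtain ⟨h0, -, s, hs, hxs⟩ := hx
  refine le_antisymm ((inf'_le _ hs).trans_eq (sum_eq_zero fun v hv => ?_))
    (massOutside_nonneg hne h0)
  exact not_not.1 fun h => mem_compl.1 hv ((hxs v).1 h)

lemma massAbove_eq_one (hx : x ∈ realization K) : massAbove hne x = 1 := by
  rw [massAbove, massOutside_eq_zero hne hx, ← hx.2.1]
  exact sum_congr rfl fun v _ => by rw [sub_zero, max_eq_left (hx.1 v)]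

lemma pushToward_eq_self (hx : x ∈ realization K) (t : ℝ) : pushToward hne t x = x := by
  funext v
  rw [pushToward, massAbove_eq_one hne hx, massOutside_eq_zero hne hx, sub_zero,
    max_eq_left (hx.1 v), max_eq_left (by norm_num)]
  ring

lemma exists_face_massOutside (h0 : ∀ v, 0 ≤ x v) :
    ∃ s ∈ K, ∀ v ∉ s, x v ≤ massOutside hne x := by
  obtain ⟨s, hs, heq⟩ := exists_mem_eq_inf' hne fun s => ∑ v ∈ sᶜ, x v
  refine ⟨s, hs, fun v hv => ?_⟩
  rw [massOutside, heq]
  exact single_le_sum (f := x) (fun w _ => h0 w) (mem_compl.2 hv)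

lemma pushToward_nonneg (h0 : ∀ v, 0 ≤ x v) {t : ℝ} (ht : t ∈ I) (v : V) :
    0 ≤ pushToward hne t x v := by
  have hpos : 0 < max (massAbove hne x) (1 / 2) := lt_max_of_lt_right (by norm_num)
  have hle : massAbove hne x / max (massAbove hne x) (1 / 2) ≤ 1 :=
    (div_le_one hpos).2 (le_max_left _ _)
  have hge : 0 ≤ massAbove hne x / max (massAbove hne x) (1 / 2) :=
    div_nonneg (massAbove_nonneg hne) hpos.le
  have h1 := ht.1
  have h2 := ht.2
  exact add_nonneg (mul_nonneg (by nlinarith) (h0 v))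
    (mul_nonneg h1 (div_nonneg (le_max_right _ _) hpos.le))

lemma sum_pushToward (h1 : ∑ v, x v = 1) (t : ℝ) : ∑ v, pushToward hne t x v = 1 := by
  simp only [pushToward, sum_add_distrib, ← mul_sum, ← sum_div, h1]
  rw [← massAbove]
  ring

lemma pushToward_mem (hL : IsComplex L) (hx : x ∈ realization L) {t : ℝ} (ht : t ∈ I) :
    pushToward hne t x ∈ realization L := by
  obtain ⟨h0, h1, s, hs, hxs⟩ := (mem_realization_iff hL).1 hx
  refine (mem_realization_iff hL).2
    ⟨pushToward_nonneg hne h0 ht, sum_pushToward hne h1 t, s, hs, fun v hv => ?_⟩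
  have := massOutside_nonneg hne h0
  rw [pushToward, hxs v hv, max_eq_right (a := 0 - massOutside hne x) (by linarith)]
  simp

lemma pushToward_one_mem (hK : IsComplex K) (h0 : ∀ v, 0 ≤ x v) (h1 : ∑ v, x v = 1)
    (hmass : 1 / 2 ≤ massAbove hne x) : pushToward hne 1 x ∈ realization K := by
  obtain ⟨s, hs, hxs⟩ := exists_face_massOutside hne h0
  refine (mem_realization_iff hK).2 ⟨pushToward_nonneg hne h0 ⟨zero_le_one, le_rfl⟩,
    sum_pushToward hne h1 1, s, hs, fun v hv => ?_⟩
  have := hxs v hv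
  rw [pushToward, max_eq_left hmass, div_self (by linarith), max_eq_right (by linarith)]
  simp

/-- The realization of a union of two complexes with contractible realizations, as a union of two
contractible subspaces. -/
lemma nonempty_contractibleTriad_realization {A B : Finset (Finset V)} (hA : IsComplex A)
    (hB : IsComplex B) (hne : (A ∩ B).Nonempty) [ContractibleSpace (realization A)]
    [ContractibleSpace (realization B)] :
    Nonempty (ContractibleTriad (realization (A ∩ B)) (realization (A ∪ B))) := by
  have hsub : ∀ i, (bif i then B else A) ⊆ A ∪ B := by
    rintro (_ | _)
    · exact subset_union_left
    · exact subset_union_right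
  have hcomplex : ∀ i, IsComplex (bif i then B else A) := by
    rintro (_ | _) <;> assumption
  have hcontr : ∀ i, ContractibleSpace (realization (bif i then B else A)) := by
    rintro (_ | _) <;> assumption
  have hinter : ∀ i, A ∩ B ⊆ bif i then B else A := by
    rintro (_ | _)
    · exact inter_subset_left
    · exact inter_subset_right
  choose y H hy hH hmem h0 h1 using fun i => exists_contraction (hsub i)
  have hAB : A ∩ B ⊆ A ∪ B := inter_subset_left.trans subset_union_left
  exact ⟨{
    incl := inclMap hAB
    isClosedEmbedding_incl :=
      .inclusion (realization_mono hAB)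
        ((isClosed_realization (hA.inter hB)).preimage continuous_subtype_val)
    side := fun i => {x | x.1 ∈ realization (bif i then B else A)}
    isClosed_side := fun i => (isClosed_realization (hcomplex i)).preimage continuous_subtype_val
    exists_mem_side := fun x =>
      (mem_realization_union x.2).elim (fun h => ⟨false, h⟩) fun h => ⟨true, h⟩
    incl_mem_side := fun i c => realization_mono (hinter i) c.2
    exists_incl_eq := fun x hx hx' => ⟨⟨x.1, mem_realization_inter hx hx'⟩, rfl⟩
    center := y
    center_mem := hy
    contract := H
    continuousOn_contract := hH
    contract_mem := hmem
    contract_zero := h0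
    contract_one := h1
    deform :=
      { toFun := fun q => ⟨pushToward hne q.1 q.2.1, pushToward_mem hne (hA.union hB) q.2.2 q.1.2⟩
        continuous_toFun := ((continuous_pushToward hne).comp
          (f := fun q : I × realization (A ∪ B) => ((q.1 : ℝ), q.2.1))
          (by fun_prop)).subtype_mk _ }
    deform_zero := fun x => Subtype.ext (by funext v; simp [pushToward])
    deform_mem := fun i t x hx => pushToward_mem hne (hcomplex i) hx t.2
    deform_incl := fun t c => Subtype.ext (pushToward_eq_self hne c.2 t)
    height :=
      { toFun := fun x => Set.projIcc 0 1 zero_le_one (2 - 2 * massAbove hne x.1)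
        continuous_toFun := continuous_projIcc.comp (by
          have := continuous_massAbove hne
          fun_prop) }
    height_incl := fun c => Set.projIcc_of_le_left zero_le_one (by
      change 2 - 2 * massAbove hne c.1 ≤ 0
      rw [massAbove_eq_one hne c.2]
      norm_num)
    deform_one_mem := fun x hx => by
      have hmass : 1 / 2 ≤ massAbove hne x.1 := by
        by_contra! hlt
        exact hx (Set.projIcc_of_right_le zero_le_one (by linarith))
      exact ⟨⟨_, pushToward_one_mem hne (hA.inter hB) x.2.1 x.2.2.1 hmass⟩, rfl⟩ }⟩

end Realization

/-- if `A`, `B` are subcomplexes of a finite simplicial complex with `A ∩ B`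
nonempty and both `|A|` and `|B|` contractible, then `|A ∪ B| ≃ susp(|A ∩ B|)`. -/
theorem realization_union_homotopyEquiv_susp
    {V : Type} [Fintype V] [DecidableEq V]
    (K A B : Finset (Finset V)) (hK : IsComplex K) (hA : IsComplex A) (hB : IsComplex B)
    (hAK : A ⊆ K) (hBK : B ⊆ K) (hne : (A ∩ B).Nonempty)
    (hcA : ContractibleSpace ↥(realization A)) (hcB : ContractibleSpace ↥(realization B)) :
    Nonempty (ContinuousMap.HomotopyEquiv (↥(realization (A ∪ B)))
      (Susp ↥(realization (A ∩ B)))) := by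
  have : Nonempty (realization (A ∩ B)) :=
    (nonempty_realization (hA.inter hB) hne).to_subtype
  obtain ⟨T⟩ := nonempty_contractibleTriad_realization hA hB hne
  exact T.nonempty_homotopyEquiv Susp.contractibleTriad
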